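/- (Sequential entropy factorization.) Let P ∈ ℝ^{m₁×m₁} and Q ∈ ℝ^{m₂×m₂} be symmetric idempotent, σ² > 0, η² > 0, γ² = η²/σ². Let Ω be a sequence of N pairwise distinct indices, let (i,j) ∉ Ω, and define the sequential criterion H((i,j)|Ω) := P_{i,i} Q_{j,j} − ν_{i,j}(Ω)ᵀ (R_N(Ω)+γ²I)^{-1} ν_{i,j}(Ω). Then the observational entropy H(Ω') := det( σ² R_{N'}(Ω') + η² I ) satisfies the exact factorization H(Ω ∪ (i,j)) = H(Ω) · σ² · ( H((i,j)|Ω) + γ² ), where Ω ∪ (i,j) is the length-(N+1) sequence obtained by appending (i,j). -/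

import Mathlib

open Matrix

noncomputable section

/-- The design covariance matrix `R_N(Ω)` with entries `P_{i_n,i_{n'}} Q_{j_n,j_{n'}}`. -/
def designR {m₁ m₂ N : ℕ} (P : Matrix (Fin m₁) (Fin m₁) ℝ) (Q : Matrix (Fin m₂) (Fin m₂) ℝ)
    (Ω : Fin N → Fin m₁ × Fin m₂) : Matrix (Fin N) (Fin N) ℝ :=
  Matrix.of fun n n' => P (Ω n).1 (Ω n').1 * Q (Ω n).2 (Ω n').2

/-- The cross-coherence vector `ν_{k,l}(Ω)` with `n`-th entry `P_{k,i_n} Q_{l,j_n}`. -/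
def nuVec {m₁ m₂ N : ℕ} (P : Matrix (Fin m₁) (Fin m₁) ℝ) (Q : Matrix (Fin m₂) (Fin m₂) ℝ)
    (Ω : Fin N → Fin m₁ × Fin m₂) (k : Fin m₁) (l : Fin m₂) : Fin N → ℝ :=
  fun n => P k (Ω n).1 * Q l (Ω n).2

/-- Conditional variance formula `v_Ω(k,l)`. -/
def condVar {m₁ m₂ N : ℕ} (σ2 γ2 : ℝ) (P : Matrix (Fin m₁) (Fin m₁) ℝ)
    (Q : Matrix (Fin m₂) (Fin m₂) ℝ) (Ω : Fin N → Fin m₁ × Fin m₂)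
    (k : Fin m₁) (l : Fin m₂) : ℝ :=
  σ2 * (P k k * Q l l -
    nuVec P Q Ω k l ⬝ᵥ ((designR P Q Ω + γ2 • (1 : Matrix (Fin N) (Fin N) ℝ))⁻¹ *ᵥ nuVec P Q Ω k l))

/-- Conditional covariance formula `c_Ω((i,j),(k,l))`. -/
def condCov {m₁ m₂ N : ℕ} (σ2 γ2 : ℝ) (P : Matrix (Fin m₁) (Fin m₁) ℝ)
    (Q : Matrix (Fin m₂) (Fin m₂) ℝ) (Ω : Fin N → Fin m₁ × Fin m₂)
    (i k : Fin m₁) (j l : Fin m₂) : ℝ :=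
  σ2 * (P i k * Q j l -
    nuVec P Q Ω i j ⬝ᵥ ((designR P Q Ω + γ2 • (1 : Matrix (Fin N) (Fin N) ℝ))⁻¹ *ᵥ nuVec P Q Ω k l))

/-- Observational entropy `H(Ω) = det(σ² R_N(Ω) + η² I)`. -/
def obsEntropy {m₁ m₂ N : ℕ} (σ2 η2 : ℝ) (P : Matrix (Fin m₁) (Fin m₁) ℝ)
    (Q : Matrix (Fin m₂) (Fin m₂) ℝ) (Ω : Fin N → Fin m₁ × Fin m₂) : ℝ :=
  (σ2 • designR P Q Ω + η2 • (1 : Matrix (Fin N) (Fin N) ℝ)).det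

/-- Sequential criterion `H((i,j)|Ω)`. -/
def seqCrit {m₁ m₂ N : ℕ} (γ2 : ℝ) (P : Matrix (Fin m₁) (Fin m₁) ℝ)
    (Q : Matrix (Fin m₂) (Fin m₂) ℝ) (Ω : Fin N → Fin m₁ × Fin m₂)
    (i : Fin m₁) (j : Fin m₂) : ℝ :=
  P i i * Q j j -
    nuVec P Q Ω i j ⬝ᵥ ((designR P Q Ω + γ2 • (1 : Matrix (Fin N) (Fin N) ℝ))⁻¹ *ᵥ nuVec P Q Ω i j)


/-- Schur-complement formula for the determinant, splitting off the last row and column. -/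
theorem det_eq_det_castSucc_mul_schur {K : Type*} [Field K] {N : ℕ}
    (A : Matrix (Fin (N + 1)) (Fin (N + 1)) K)
    (hA : IsUnit (A.submatrix Fin.castSucc Fin.castSucc)) :
    A.det = (A.submatrix Fin.castSucc Fin.castSucc).det *
      (A (Fin.last N) (Fin.last N) - (fun n : Fin N => A (Fin.last N) n.castSucc) ⬝ᵥ
        ((A.submatrix Fin.castSucc Fin.castSucc)⁻¹ *ᵥ
          fun n : Fin N => A n.castSucc (Fin.last N))) := by
  set M := A.submatrix Fin.castSucc Fin.castSucc with hM
  have hblocks : A.submatrix finSumFinEquiv finSumFinEquiv =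
      fromBlocks M (replicateCol (Fin 1) fun n : Fin N => A n.castSucc (Fin.last N))
        (replicateRow (Fin 1) fun n : Fin N => A (Fin.last N) n.castSucc)
        (of fun _ _ => A (Fin.last N) (Fin.last N)) := by
    have hlast (x : Fin 1) : Fin.natAdd N x = Fin.last N := by
      rw [Subsingleton.elim x 0]; rfl
    ext (a | a) (b | b) <;> simp [hM, hlast] <;> rfl
  let := hA.invertible
  rw [← det_submatrix_equiv_self finSumFinEquiv A, hblocks, det_fromBlocks₁₁, det_fin_one,
    invOf_eq_nonsing_inv, Matrix.mul_assoc, ← replicateCol_mulVec]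
  simp [Matrix.mul_apply, dotProduct]

/-- A real symmetric idempotent matrix is positive semidefinite. -/
theorem posSemidef_of_transpose_eq_of_idem {n : Type*} [Fintype n] {P : Matrix n n ℝ}
    (hsymm : Pᵀ = P) (hidem : P * P = P) : P.PosSemidef := by
  have h := posSemidef_conjTranspose_mul_self P
  rwa [conjTranspose_eq_transpose_of_trivial, hsymm, hidem] at h

theorem designR_posSemidef {m₁ m₂ N : ℕ} {P : Matrix (Fin m₁) (Fin m₁) ℝ}
    {Q : Matrix (Fin m₂) (Fin m₂) ℝ} (hP : P.PosSemidef) (hQ : Q.PosSemidef)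
    (Ω : Fin N → Fin m₁ × Fin m₂) : (designR P Q Ω).PosSemidef :=
  (hP.kronecker hQ).submatrix Ω

theorem obsEntropy_eq_pow_mul_det {m₁ m₂ N : ℕ} (P : Matrix (Fin m₁) (Fin m₁) ℝ)
    (Q : Matrix (Fin m₂) (Fin m₂) ℝ) {σ2 : ℝ} (hσ2 : σ2 ≠ 0) (η2 : ℝ)
    (Ω : Fin N → Fin m₁ × Fin m₂) :
    obsEntropy σ2 η2 P Q Ω =
      σ2 ^ N * (designR P Q Ω + (η2 / σ2) • (1 : Matrix (Fin N) (Fin N) ℝ)).det := by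
  have h : σ2 • designR P Q Ω + η2 • (1 : Matrix (Fin N) (Fin N) ℝ) =
      σ2 • (designR P Q Ω + (η2 / σ2) • (1 : Matrix (Fin N) (Fin N) ℝ)) := by
    rw [smul_add, smul_smul, mul_div_cancel₀ _ hσ2]
  rw [obsEntropy, h, det_smul, Fintype.card_fin]

/-- **Sequential entropy factorization.** The observational entropy
`H(Ω) = det(σ² R_N(Ω) + η² I)` satisfies the exact Schur-complement factorization
`H(Ω ∪ (i,j)) = H(Ω) · σ² · (H((i,j)|Ω) + γ²)`. -/
theorem obsEntropy_snoc_factorization {m₁ m₂ N : ℕ}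
    (P : Matrix (Fin m₁) (Fin m₁) ℝ) (Q : Matrix (Fin m₂) (Fin m₂) ℝ)
    (hPsymm : Pᵀ = P) (hPidem : P * P = P)
    (hQsymm : Qᵀ = Q) (hQidem : Q * Q = Q)
    (σ2 η2 γ2 : ℝ) (hσ2 : 0 < σ2) (hη2 : 0 < η2) (hγ2 : γ2 = η2 / σ2)
    (Ω : Fin N → Fin m₁ × Fin m₂) (hΩ : Function.Injective Ω)
    (i : Fin m₁) (j : Fin m₂) (hij : ∀ n, Ω n ≠ (i, j)) :
    obsEntropy σ2 η2 P Q (Fin.snoc Ω (i, j)) =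
      obsEntropy σ2 η2 P Q Ω * σ2 * (seqCrit γ2 P Q Ω i j + γ2) := by
  have hPD : (designR P Q Ω + γ2 • (1 : Matrix (Fin N) (Fin N) ℝ)).PosDef :=
    PosDef.posSemidef_add
      (designR_posSemidef (posSemidef_of_transpose_eq_of_idem hPsymm hPidem)
        (posSemidef_of_transpose_eq_of_idem hQsymm hQidem) Ω)
      (PosDef.one.smul (hγ2 ▸ div_pos hη2 hσ2))
  have hsub : (designR P Q (Fin.snoc Ω (i, j) : Fin (N + 1) → Fin m₁ × Fin m₂) +
      γ2 • (1 : Matrix (Fin (N + 1)) (Fin (N + 1)) ℝ)).submatrix Fin.castSucc Fin.castSucc =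
      designR P Q Ω + γ2 • (1 : Matrix (Fin N) (Fin N) ℝ) := by
    ext a b
    simp [designR, Matrix.one_apply]
  have hP (a b) : P a b = P b a := congrFun₂ hPsymm.symm a b
  have hQ (a b) : Q a b = Q b a := congrFun₂ hQsymm.symm a b
  have hrow : (fun n : Fin N => (designR P Q (Fin.snoc Ω (i, j) : Fin (N + 1) → Fin m₁ × Fin m₂) +
      γ2 • (1 : Matrix (Fin (N + 1)) (Fin (N + 1)) ℝ)) (Fin.last N) n.castSucc) =
      nuVec P Q Ω i j := by
    ext n
    simp [designR, nuVec, (Fin.castSucc_ne_last n).symm]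
  have hcol : (fun n : Fin N => (designR P Q (Fin.snoc Ω (i, j) : Fin (N + 1) → Fin m₁ × Fin m₂) +
      γ2 • (1 : Matrix (Fin (N + 1)) (Fin (N + 1)) ℝ)) n.castSucc (Fin.last N)) =
      nuVec P Q Ω i j := by
    ext n
    simp [designR, nuVec, hP i, hQ j]
  have hlast : (designR P Q (Fin.snoc Ω (i, j) : Fin (N + 1) → Fin m₁ × Fin m₂) +
      γ2 • (1 : Matrix (Fin (N + 1)) (Fin (N + 1)) ℝ)) (Fin.last N) (Fin.last N) =
      P i i * Q j j + γ2 := by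
    simp [designR]
  rw [obsEntropy_eq_pow_mul_det P Q hσ2.ne', obsEntropy_eq_pow_mul_det P Q hσ2.ne', ← hγ2,
    det_eq_det_castSucc_mul_schur _ (hsub ▸ hPD.isUnit), hsub, hrow, hcol, hlast, seqCrit]
  ring

end
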